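/- Fix κ_z > 0 and unit vectors μ_y, μ_z ∈ ℝ^p, and for κ_y > 0 let d_ℓ(κ_y) denote the Kullback–Leibler divergence of the von Mises–Fisher distribution with parameters (κ_y, μ_y) from the one with parameters (κ_z, μ_z). Then d_ℓ(κ_y) = O(ln κ_y) as κ_y → ∞: there exist constants C > 0 and K ≥ max(κ_z, e) such that |d_ℓ(κ_y)| ≤ C·ln(κ_y) for all κ_y ≥ K. -/

import Mathlib

open MeasureTheory Real
open scoped RealInnerProductSpace

/-- `ν = p/2 − 1`. -/
noncomputable def nuOf (p : ℕ) : ℝ := (p : ℝ) / 2 - 1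

/-- The modified Bessel function of the first kind,
`I_ν(z) = (z/2)^ν ∑_{k=0}^∞ (z/2)^{2k}/(k!·Γ(ν+k+1))`. -/
noncomputable def besselI (ν z : ℝ) : ℝ :=
  (z / 2) ^ ν * ∑' k : ℕ, (z / 2) ^ (2 * k) / (Nat.factorial k * Real.Gamma (ν + k + 1))

/-- The ratio of modified Bessel functions `r_ν(κ) = I_{ν+1}(κ)/I_ν(κ)`. -/
noncomputable def besselRatio (ν κ : ℝ) : ℝ := besselI (ν + 1) κ / besselI ν κ

/-- The standard surface measure on the unit sphere in `ℝ^p`. -/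
noncomputable def sphereMeasure (p : ℕ) :
    Measure (Metric.sphere (0 : EuclideanSpace ℝ (Fin p)) 1) :=
  (volume : Measure (EuclideanSpace ℝ (Fin p))).toSphere

/-- The von Mises–Fisher partition function `C_ν(κ) = (2π)^{ν+1} I_ν(κ)/κ^ν`. -/
noncomputable def vmfC (ν κ : ℝ) : ℝ := (2 * Real.pi) ^ (ν + 1) * besselI ν κ / κ ^ ν

/-- The von Mises–Fisher density `f_p(x;κ,μ) = exp(κ⟨μ,x⟩)/C_ν(κ)`. -/
noncomputable def vmf (p : ℕ) (κ : ℝ) (μ x : EuclideanSpace ℝ (Fin p)) : ℝ :=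
  Real.exp (κ * ⟪μ, x⟫) / vmfC (nuOf p) κ

/-- The uniform density on the unit sphere in `ℝ^p`, `u(x) = Γ(ν+1)/(2π^{ν+1})`. -/
noncomputable def uniformDensity (p : ℕ) : ℝ :=
  Real.Gamma (nuOf p + 1) / (2 * Real.pi ^ (nuOf p + 1))

/-- The Kullback–Leibler divergence of `f_p(·;κ_y,μ_y)` from `f_p(·;κ_z,μ_z)`. -/
noncomputable def klDiv (p : ℕ) (κy κz : ℝ) (μy μz : EuclideanSpace ℝ (Fin p)) : ℝ :=
  ∫ x : Metric.sphere (0 : EuclideanSpace ℝ (Fin p)) 1,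
    Real.log (vmf p κy μy (x : EuclideanSpace ℝ (Fin p))
        / vmf p κz μz (x : EuclideanSpace ℝ (Fin p)))
      * vmf p κy μy (x : EuclideanSpace ℝ (Fin p)) ∂(sphereMeasure p)


lemma aux_radial (m : ℕ) :
    ∫ r in Set.Ioi (0:ℝ), r ^ m * Real.exp (-r^2) = Real.Gamma (((m:ℝ) + 1) / 2) / 2 := by
  have h := integral_rpow_mul_exp_neg_rpow (p := 2) (q := m) (by norm_num)
    (by have : (0:ℝ) ≤ m := Nat.cast_nonneg m
        linarith)
  simp only [Real.rpow_natCast, Real.rpow_ofNat] at h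
  rw [h]; ring

lemma aux_radial_even (k : ℕ) :
    ∫ r : ℝ, r ^ (2*k) * Real.exp (-r^2) = Real.Gamma ((k:ℝ) + 1 / 2) := by
  have h := integral_comp_abs (f := fun r : ℝ => r ^ (2*k) * Real.exp (-r^2))
  simp only [sq_abs, pow_mul] at h
  simp only [pow_mul]
  rw [h]
  have h2 := aux_radial (2*k)
  simp only [pow_mul] at h2
  rw [h2]
  push_cast
  rw [show (2 * (k:ℝ) + 1)/2 = k + 1/2 by ring]
  ring

lemma aux_radial_odd (k : ℕ) :
    ∫ r : ℝ, r ^ (2*k+1) * Real.exp (-r^2) = 0 := by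
  have h := integral_neg_eq_self (fun r : ℝ => r ^ (2*k+1) * Real.exp (-r^2)) volume
  have h2 : ∀ r : ℝ, (-r) ^ (2*k+1) * Real.exp (-(-r)^2) = -(r ^ (2*k+1) * Real.exp (-r^2)) := by
    intro r
    rw [Odd.neg_pow ⟨k, rfl⟩, neg_sq]; ring
  simp only [h2, integral_neg] at h
  linarith

lemma aux_gauss (p : ℕ) (hp : 2 ≤ p) (μ : EuclideanSpace ℝ (Fin p)) (hμ : ‖μ‖ = 1) (n : ℕ) :
    ∫ x : EuclideanSpace ℝ (Fin p), ⟪μ, x⟫ ^ n * Real.exp (-‖x‖^2) =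
      (∫ r : ℝ, r ^ n * Real.exp (-r^2)) * (√π) ^ (p - 1) := by
  obtain ⟨q, rfl⟩ : ∃ q, p = q + 1 := ⟨p - 1, by omega⟩
  obtain ⟨b, hb⟩ := Orthonormal.exists_orthonormalBasis_extension_of_card_eq (𝕜 := ℝ)
    (E := EuclideanSpace ℝ (Fin (q+1))) (ι := Fin (q+1)) (by simp) (v := fun _ => μ) (s := {0})
    (by
      constructor
      · intro i; simpa using hμ
      · intro i j hij
        exact absurd (Subsingleton.elim i j) hij)
  have hb0 : b 0 = μ := hb 0 rfl
  have h1 := b.measurePreserving_repr.integral_comp b.repr.toHomeomorph.measurableEmbedding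
    (fun y : EuclideanSpace ℝ (Fin (q+1)) => (y 0) ^ n * Real.exp (-‖y‖^2))
  have h2 : ∀ x, (b.repr x) 0 = ⟪μ, x⟫ := by
    intro x; rw [b.repr_apply_apply, hb0]
  simp only [h2, LinearIsometryEquiv.norm_map] at h1
  rw [h1]
  have h3 := (EuclideanSpace.volume_preserving_symm_measurableEquiv_toLp (Fin (q+1))).symm.integral_comp
    (MeasurableEquiv.measurableEmbedding _)
    (fun y : EuclideanSpace ℝ (Fin (q+1)) => (y 0) ^ n * Real.exp (-‖y‖^2))
  rw [← h3]
  have h4 : ∀ y : Fin (q+1) → ℝ,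
      (((MeasurableEquiv.toLp 2 (Fin (q+1) → ℝ)).symm.symm y) 0) ^ n *
        Real.exp (-‖(MeasurableEquiv.toLp 2 (Fin (q+1) → ℝ)).symm.symm y‖^2) =
      ∏ i, (fun (i : Fin (q+1)) (t : ℝ) => if i = 0 then t ^ n * Real.exp (-t^2) else Real.exp (-t^2)) i (y i) := by
    intro y
    rw [EuclideanSpace.norm_sq_eq, Fin.prod_univ_succ]
    simp [Fin.sum_univ_succ, Real.exp_add, Real.exp_sum, mul_assoc, ← Finset.sum_neg_distrib, Fin.succ_ne_zero]
    left; ring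
  rw [integral_congr_ae (Filter.Eventually.of_forall h4)]
  refine (MeasureTheory.integral_fintype_prod_volume_eq_prod (fun (i : Fin (q+1)) (t : ℝ) => if i = 0 then t ^ n * Real.exp (-t^2) else Real.exp (-t^2))).trans ?_
  rw [Fin.prod_univ_succ]
  have hg : ∫ t : ℝ, Real.exp (-t^2) = √π := by
    have := integral_gaussian 1
    simpa using this
  simp [Fin.succ_ne_zero, hg]

lemma aux_polar (p : ℕ) (hp : 2 ≤ p) (μ : EuclideanSpace ℝ (Fin p)) (n : ℕ) :
    ∫ x : EuclideanSpace ℝ (Fin p), ⟪μ, x⟫ ^ n * Real.exp (-‖x‖^2) =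
      (∫ x : Metric.sphere (0 : EuclideanSpace ℝ (Fin p)) 1, ⟪μ, (x : EuclideanSpace ℝ (Fin p))⟫ ^ n
        ∂(sphereMeasure p)) * (Real.Gamma (((n:ℝ) + p) / 2) / 2) := by
  have : Nonempty (Fin p) := ⟨⟨0, by omega⟩⟩
  have hm := (volume : Measure (EuclideanSpace ℝ (Fin p))).measurePreserving_homeomorphUnitSphereProd
  have hd : Module.finrank ℝ (EuclideanSpace ℝ (Fin p)) = p := by simp
  rw [hd] at hm
  calc ∫ x : EuclideanSpace ℝ (Fin p), ⟪μ, x⟫ ^ n * Real.exp (-‖x‖^2)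
      = ∫ x : ({(0)}ᶜ : Set (EuclideanSpace ℝ (Fin p))), ⟪μ, x.1⟫ ^ n * Real.exp (-‖x.1‖^2)
          ∂(Measure.comap Subtype.val volume) := by
        rw [integral_subtype_comap (measurableSet_singleton _).compl
          fun x : EuclideanSpace ℝ (Fin p) ↦ ⟪μ, x⟫ ^ n * Real.exp (-‖x‖^2),
          restrict_compl_singleton]
    _ = ∫ z : Metric.sphere (0 : EuclideanSpace ℝ (Fin p)) 1 × Set.Ioi (0:ℝ),
          ⟪μ, (z.1 : EuclideanSpace ℝ (Fin p))⟫ ^ n * ((z.2:ℝ) ^ n * Real.exp (-(z.2:ℝ)^2))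
          ∂((sphereMeasure p).prod (.volumeIoiPow (p - 1))) := by
        unfold sphereMeasure
        rw [← hm.integral_comp (Homeomorph.measurableEmbedding _)]
        refine integral_congr_ae (Filter.Eventually.of_forall fun x => ?_)
        have hx : ‖x.1‖ ≠ 0 := norm_ne_zero_iff.2 x.2
        simp only [homeomorphUnitSphereProd_apply_snd_coe, homeomorphUnitSphereProd_apply_fst_coe,
          inner_smul_right]
        rw [← mul_assoc, ← mul_pow]
        congr 2
        field_simp
    _ = (∫ x : Metric.sphere (0 : EuclideanSpace ℝ (Fin p)) 1, ⟪μ, (x : EuclideanSpace ℝ (Fin p))⟫ ^ n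
        ∂(sphereMeasure p)) * ∫ r : Set.Ioi (0:ℝ), ((r:ℝ) ^ n * Real.exp (-(r:ℝ)^2))
          ∂(Measure.volumeIoiPow (p - 1)) := by
        have : SFinite (sphereMeasure p) := by unfold sphereMeasure; infer_instance
        exact integral_prod_mul (μ := sphereMeasure p) (ν := Measure.volumeIoiPow (p-1))
          (fun x : Metric.sphere (0 : EuclideanSpace ℝ (Fin p)) 1 => ⟪μ, (x : EuclideanSpace ℝ (Fin p))⟫ ^ n)
          (fun r : Set.Ioi (0:ℝ) => ((r:ℝ) ^ n * Real.exp (-(r:ℝ)^2)))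
    _ = _ := by
        congr 1
        simp only [Measure.volumeIoiPow, ENNReal.ofReal]
        rw [integral_withDensity_eq_integral_smul
          ((measurable_subtype_coe.pow_const _).real_toNNReal),
          integral_subtype_comap measurableSet_Ioi
            fun a : ℝ ↦ Real.toNNReal (a ^ (p - 1)) • (a ^ n * Real.exp (-a^2))]
        have := aux_radial (p - 1 + n)
        rw [show ((n:ℝ) + p) = ((p - 1 + n : ℕ):ℝ) + 1 by
          push_cast [Nat.cast_sub (show 1 ≤ p by omega)]; ring, ← this]
        refine setIntegral_congr_fun measurableSet_Ioi fun x hx ↦ ?_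
        rw [NNReal.smul_def, Real.coe_toNNReal _ (pow_nonneg (le_of_lt hx) _), smul_eq_mul, pow_add]
        ring

lemma aux_moment_even (p : ℕ) (hp : 2 ≤ p) (μ : EuclideanSpace ℝ (Fin p)) (hμ : ‖μ‖ = 1) (k : ℕ) :
    ∫ x : Metric.sphere (0 : EuclideanSpace ℝ (Fin p)) 1, ⟪μ, (x : EuclideanSpace ℝ (Fin p))⟫ ^ (2 * k)
        ∂(sphereMeasure p) =
      2 * Real.Gamma ((k:ℝ) + 1 / 2) * (√π) ^ (p - 1) / Real.Gamma ((k:ℝ) + p / 2) := by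
  have h := aux_polar p hp μ (2*k)
  rw [aux_gauss p hp μ hμ, aux_radial_even] at h
  push_cast at h
  rw [show (2 * (k:ℝ) + p) / 2 = k + p / 2 by ring] at h
  have hp0 : (0:ℝ) < p := by exact_mod_cast (by omega : 0 < p)
  have hG : 0 < Real.Gamma ((k:ℝ) + p / 2) := Real.Gamma_pos_of_pos (by positivity)
  rw [eq_div_iff hG.ne']
  linarith

lemma aux_moment_odd (p : ℕ) (hp : 2 ≤ p) (μ : EuclideanSpace ℝ (Fin p)) (hμ : ‖μ‖ = 1) (k : ℕ) :
    ∫ x : Metric.sphere (0 : EuclideanSpace ℝ (Fin p)) 1, ⟪μ, (x : EuclideanSpace ℝ (Fin p))⟫ ^ (2 * k + 1)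
        ∂(sphereMeasure p) = 0 := by
  have h := aux_polar p hp μ (2*k+1)
  rw [aux_gauss p hp μ hμ, aux_radial_odd, zero_mul] at h
  have hp0 : (0:ℝ) < p := by exact_mod_cast (by omega : 0 < p)
  have hG : 0 < Real.Gamma ((((2 * k + 1 : ℕ):ℝ) + p) / 2) := Real.Gamma_pos_of_pos (by positivity)
  rcases mul_eq_zero.1 h.symm with h | h
  · exact h
  · linarith

lemma aux_finite (p : ℕ) : IsFiniteMeasure (sphereMeasure p) := by
  unfold sphereMeasure; infer_instance

lemma aux_inner_le {p : ℕ} {μ : EuclideanSpace ℝ (Fin p)} (hμ : ‖μ‖ = 1)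
    (x : Metric.sphere (0 : EuclideanSpace ℝ (Fin p)) 1) :
    |⟪μ, (x : EuclideanSpace ℝ (Fin p))⟫| ≤ 1 := by
  have := abs_real_inner_le_norm μ (x : EuclideanSpace ℝ (Fin p))
  simpa [hμ] using this

lemma aux_duplication (k : ℕ) :
    Real.Gamma ((k:ℝ) + 1 / 2) * (4 ^ k * (k.factorial : ℝ)) = (2 * k).factorial * √π := by
  have h := Real.Gamma_mul_Gamma_add_half ((k:ℝ) + 1/2)
  rw [show (k:ℝ) + 1/2 + 1/2 = k + 1 by ring, Real.Gamma_nat_eq_factorial,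
    show 2 * ((k:ℝ) + 1/2) = ((2 * k : ℕ) : ℝ) + 1 by push_cast; ring,
    Real.Gamma_nat_eq_factorial,
    show 1 - (((2 * k : ℕ) : ℝ) + 1) = -((2 * k : ℕ) : ℝ) by ring,
    Real.rpow_neg (by norm_num), Real.rpow_natCast, pow_mul] at h
  norm_num at h
  have h4 : (4:ℝ)^k ≠ 0 := by positivity
  calc Real.Gamma ((k:ℝ) + 1 / 2) * (4 ^ k * (k.factorial : ℝ)) =
    (Real.Gamma ((k:ℝ) + 1 / 2) * (k.factorial : ℝ)) * 4 ^ k := by ring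
    _ = _ := by
      norm_num
      rw [h]; field_simp

lemma aux_partition (p : ℕ) (hp : 2 ≤ p) (μ : EuclideanSpace ℝ (Fin p)) (hμ : ‖μ‖ = 1)
    (κ : ℝ) (hκ : 0 < κ) :
    ∫ x : Metric.sphere (0 : EuclideanSpace ℝ (Fin p)) 1,
      Real.exp (κ * ⟪μ, (x : EuclideanSpace ℝ (Fin p))⟫) ∂(sphereMeasure p) = vmfC (nuOf p) κ := by
  have := aux_finite p
  have hs := hasSum_integral_of_dominated_convergence (μ := sphereMeasure p)
    (F := fun (n : ℕ) (x : Metric.sphere (0 : EuclideanSpace ℝ (Fin p)) 1) =>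
      κ ^ n / n.factorial * ⟪μ, (x : EuclideanSpace ℝ (Fin p))⟫ ^ n)
    (f := fun x => Real.exp (κ * ⟪μ, (x : EuclideanSpace ℝ (Fin p))⟫))
    (bound := fun n _ => κ ^ n / n.factorial)
    (fun n => (by fun_prop : Continuous _).aestronglyMeasurable)
    (fun n => Filter.Eventually.of_forall fun x => by
      rw [norm_mul, norm_pow, Real.norm_eq_abs, Real.norm_eq_abs, abs_of_nonneg (by positivity)]
      exact mul_le_of_le_one_right (by positivity) (pow_le_one₀ (abs_nonneg _) (aux_inner_le hμ x)))
    (Filter.Eventually.of_forall fun x => Real.summable_pow_div_factorial κ)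
    (integrable_const _)
    (Filter.Eventually.of_forall fun x => by
      have h := NormedSpace.expSeries_div_hasSum_exp (κ * ⟪μ, (x : EuclideanSpace ℝ (Fin p))⟫)
      rw [← Real.exp_eq_exp_ℝ] at h
      refine h.congr_fun ?_
      intro n
      rw [mul_pow]; ring)
  rw [← hs.tsum_eq]
  simp only [integral_const_mul]
  have hinj : Function.Injective (fun k : ℕ => 2 * k) := fun a b h => by simpa using h
  rw [← hinj.tsum_eq]
  · simp only [aux_moment_even p hp μ hμ]
    unfold vmfC besselI
    have hp0 : (0:ℝ) < p := by exact_mod_cast (by omega : 0 < p)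
    have e1 : (2 * π) ^ (nuOf p + 1) * ((κ/2)^(nuOf p) * ∑' k : ℕ, (κ / 2) ^ (2 * k) / (Nat.factorial k * Real.Gamma (nuOf p + k + 1))) / κ ^ (nuOf p) = (2 * π ^ (nuOf p + 1)) * ∑' k : ℕ, (κ / 2) ^ (2 * k) / (Nat.factorial k * Real.Gamma (nuOf p + k + 1)) := by
      rw [Real.mul_rpow (by norm_num) Real.pi_pos.le, Real.div_rpow hκ.le (by norm_num),
        Real.rpow_add_one (by norm_num : (2:ℝ) ≠ 0)]
      have : (2:ℝ)^(nuOf p) ≠ 0 := by positivity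
      have : κ^(nuOf p) ≠ 0 := by positivity
      field_simp
    rw [e1, ← tsum_mul_left]
    congr 1
    ext k
    have hnu : nuOf p + k + 1 = k + p/2 := by unfold nuOf; ring
    have hpi : √π * √π ^ (p - 1) = π ^ (nuOf p + 1) := by
      rw [← pow_succ', Nat.sub_add_cancel (by omega), Real.sqrt_eq_rpow, ← Real.rpow_natCast,
        ← Real.rpow_mul Real.pi_pos.le]
      congr 1; unfold nuOf; ring
    have hG : 0 < Real.Gamma ((k:ℝ) + p / 2) := Real.Gamma_pos_of_pos (by positivity)
    rw [hnu, ← hpi]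
    have hd := aux_duplication k
    have hf : ((2*k).factorial : ℝ) ≠ 0 := by positivity
    have hf' : (k.factorial : ℝ) ≠ 0 := by positivity
    have hpw : (κ/2)^(2*k) = κ^(2*k) / 4^k := by rw [div_pow, pow_mul 2]; norm_num
    rw [hpw]
    have h4 : (4:ℝ)^k ≠ 0 := by positivity
    generalize Real.Gamma ((k:ℝ) + 1 / 2) = g at *
    generalize Real.Gamma ((k:ℝ) + p / 2) = g' at *
    have := hG.ne'
    field_simp
    linear_combination hd
  · intro n hn
    rcases Nat.even_or_odd' n with ⟨k, rfl | rfl⟩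
    · exact ⟨k, rfl⟩
    · exact absurd (by simp [aux_moment_odd p hp μ hμ]) hn

lemma aux_upper (p : ℕ) (hp : 2 ≤ p) (μ : EuclideanSpace ℝ (Fin p)) (hμ : ‖μ‖ = 1)
    (κ : ℝ) (hκ : 0 < κ) : vmfC (nuOf p) κ ≤ (sphereMeasure p).real Set.univ * Real.exp κ := by
  have := aux_finite p
  rw [← aux_partition p hp μ hμ κ hκ]
  have h : ∀ x : Metric.sphere (0 : EuclideanSpace ℝ (Fin p)) 1,
      ‖Real.exp (κ * ⟪μ, (x : EuclideanSpace ℝ (Fin p))⟫)‖ ≤ Real.exp κ := by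
    intro x
    rw [Real.norm_eq_abs, abs_of_pos (Real.exp_pos _)]
    apply Real.exp_le_exp.2
    have := (abs_le.1 (aux_inner_le hμ x)).2
    nlinarith
  have h2 := norm_integral_le_of_norm_le_const (μ := sphereMeasure p) (Filter.Eventually.of_forall h)
  rw [mul_comm]
  exact (le_abs_self _).trans h2

lemma aux_lower (p : ℕ) (hp : 2 ≤ p) (μ : EuclideanSpace ℝ (Fin p)) (hμ : ‖μ‖ = 1) :
    ∃ c > 0, ∀ κ : ℝ, 1 ≤ κ → c * Real.exp κ / κ ^ p ≤ vmfC (nuOf p) κ := by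
  have := aux_finite p
  have : Nonempty (Fin p) := ⟨⟨0, by omega⟩⟩
  have hp0 : (0:ℝ) < p := by exact_mod_cast (by omega : 0 < p)
  set V := (volume : Measure (EuclideanSpace ℝ (Fin p))).real (Metric.ball 0 1) with hV
  have hVpos : 0 < V := by
    rw [hV, measureReal_def]
    exact ENNReal.toReal_pos (Metric.measure_ball_pos _ _ one_pos).ne' measure_ball_lt_top.ne
  refine ⟨p * (1/4)^p * V * Real.exp (-1), by positivity, ?_⟩
  intro κ hκ
  have hκ0 : 0 < κ := by linarith
  rw [← aux_partition p hp μ hμ κ hκ0]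
  let m : Metric.sphere (0 : EuclideanSpace ℝ (Fin p)) 1 := ⟨μ, by simpa using hμ⟩
  have hb := Measure.toSphereBallBound_mul_measureReal_unitBall_le_toSphere_ball
    (volume : Measure (EuclideanSpace ℝ (Fin p))) (ε := 1/κ) (by positivity) m
  rw [Measure.toSphereBallBound] at hb
  have hk1 : 1/κ ≤ 2 := by
    rw [div_le_iff₀ hκ0]; linarith
  have hmin : min (Real.toNNReal (1/κ)) 2 = Real.toNNReal (1/κ) := by
    apply min_eq_left
    rw [Real.toNNReal_le_iff_le_coe]; simpa using hk1
  rw [if_pos ⟨by simp; omega, by positivity⟩, hmin] at hb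
  have hb' : p * (1/κ/4)^p * V ≤ (sphereMeasure p).real (Metric.ball m (1/κ)) := by
    have hc : ((Real.toNNReal (1/κ) : NNReal) : ℝ) = 1/κ := Real.coe_toNNReal _ (by positivity)
    push_cast at hb
    rw [hc] at hb
    simpa [sphereMeasure] using hb
  have hint : Integrable (fun x : Metric.sphere (0 : EuclideanSpace ℝ (Fin p)) 1 =>
      Real.exp (κ * ⟪μ, (x : EuclideanSpace ℝ (Fin p))⟫)) (sphereMeasure p) :=
    (by fun_prop : Continuous _).integrable_of_hasCompactSupport
      (HasCompactSupport.of_compactSpace _)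
  calc p * (1/4)^p * V * Real.exp (-1) * Real.exp κ / κ ^ p
      = Real.exp (κ - 1) * (p * (1/κ/4)^p * V) := by
        rw [sub_eq_add_neg, Real.exp_add, div_pow, div_pow, div_pow]
        field_simp
    _ ≤ Real.exp (κ - 1) * (sphereMeasure p).real (Metric.ball m (1/κ)) := by gcongr
    _ ≤ ∫ x in Metric.ball m (1/κ), Real.exp (κ * ⟪μ, (x : EuclideanSpace ℝ (Fin p))⟫)
          ∂(sphereMeasure p) := by
        refine setIntegral_ge_of_const_le_real measurableSet_ball (measure_ne_top _ _) ?_ hint.integrableOn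
        intro x hx
        apply Real.exp_le_exp.2
        have hd : ‖(x : EuclideanSpace ℝ (Fin p)) - μ‖ < 1/κ := by
          have := Metric.mem_ball.1 hx
          rwa [Subtype.dist_eq, dist_eq_norm] at this
        have hi : ⟪μ, (x : EuclideanSpace ℝ (Fin p))⟫ = 1 + ⟪μ, (x : EuclideanSpace ℝ (Fin p)) - μ⟫ := by
          rw [inner_sub_right, real_inner_self_eq_norm_sq, hμ]; ring
        have hj := (abs_le.1 (abs_real_inner_le_norm μ ((x : EuclideanSpace ℝ (Fin p)) - μ))).1
        rw [hμ, one_mul] at hj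
        have : κ * (1/κ) = 1 := by field_simp
        rw [hi]
        nlinarith
    _ ≤ _ := setIntegral_le_integral hint (Filter.Eventually.of_forall fun x => (Real.exp_pos _).le)

/-- The Kullback–Leibler divergence between two von Mises–Fisher distributions
is `O(ln κ_y)` as `κ_y → ∞`. -/
theorem kl_divergence_bigO_log (p : ℕ) (hp : 2 ≤ p)
    (κz : ℝ) (hκz : 0 < κz)
    (μy μz : EuclideanSpace ℝ (Fin p)) (hμy : ‖μy‖ = 1) (hμz : ‖μz‖ = 1) :
    ∃ C > (0 : ℝ), ∃ K : ℝ, max κz (Real.exp 1) ≤ K ∧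
      ∀ κy ≥ K, |klDiv p κy κz μy μz| ≤ C * Real.log κy := by
  have := aux_finite p
  obtain ⟨c, hc, hlow⟩ := aux_lower p hp μy hμy
  set S := (sphereMeasure p).real Set.univ with hS
  set Cz := vmfC (nuOf p) κz with hCz
  have hpos : ∀ κ : ℝ, 0 < κ → 0 < vmfC (nuOf p) κ := by
    intro κ hκ
    rw [← aux_partition p hp μy hμy κ hκ]
    have : NeZero (sphereMeasure p) := by
      have : Nonempty (Fin p) := ⟨⟨0, by omega⟩⟩
      unfold sphereMeasure
      exact ⟨Measure.toSphere_ne_zero _⟩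
    exact integral_exp_pos ((by fun_prop : Continuous _).integrable_of_hasCompactSupport
      (HasCompactSupport.of_compactSpace _))
  have hS0 : 0 < S := by
    have h1 := hpos 1 one_pos
    have h2 := aux_upper p hp μy hμy 1 one_pos
    by_contra hn
    have h3 : S * Real.exp 1 ≤ 0 := mul_nonpos_of_nonpos_of_nonneg (not_lt.1 hn) (Real.exp_pos _).le
    linarith
  have hCz0 : 0 < Cz := hpos κz hκz
  set D0 := κz + |Real.log Cz| + |Real.log S| + |Real.log c| with hD0
  have hD0nn : 0 ≤ D0 := by positivity
  refine ⟨2 * p + 1 + D0 + 2 * S / c, by positivity, max κz (Real.exp 1), le_rfl, ?_⟩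
  intro κ hκ
  have hκe : Real.exp 1 ≤ κ := (le_max_right _ _).trans hκ
  have hκ1 : 1 ≤ κ := (Real.one_le_exp zero_le_one).trans hκe
  have hκ0 : 0 < κ := by linarith
  have hlog : 1 ≤ Real.log κ := (Real.le_log_iff_exp_le hκ0).2 hκe
  set Cy := vmfC (nuOf p) κ with hCy
  have hCy0 : 0 < Cy := hpos κ hκ0
  have hup : Real.log Cy ≤ Real.log S + κ := by
    have := Real.log_le_log hCy0 (aux_upper p hp μy hμy κ hκ0)
    rwa [Real.log_mul hS0.ne' (Real.exp_pos _).ne', Real.log_exp] at this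
  have hlo : Real.log c + κ - p * Real.log κ ≤ Real.log Cy := by
    have := Real.log_le_log (by positivity) (hlow κ hκ1)
    rwa [Real.log_div (by positivity) (by positivity), Real.log_mul hc.ne' (Real.exp_pos _).ne',
      Real.log_exp, Real.log_pow] at this
  set L := ((p:ℝ) + 1) * Real.log κ with hL
  have hexpL : Real.exp (-L) = 1 / κ ^ (p + 1) := by
    rw [hL, Real.exp_neg, mul_comm, Real.exp_mul, Real.exp_log hκ0, one_div]
    congr 1
    exact_mod_cast Real.rpow_natCast κ (p+1)
  have hratio : Real.exp κ / Cy ≤ κ ^ p / c := by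
    have := hlow κ hκ1
    rw [div_le_iff₀ (by positivity)] at this
    rw [div_le_div_iff₀ hCy0 hc]
    linarith
  set D := D0 + p * Real.log κ with hD
  have hDnn : 0 ≤ D := by positivity
  have hLnn : 0 ≤ L := by positivity
  let f : Metric.sphere (0 : EuclideanSpace ℝ (Fin p)) 1 → ℝ := fun x => vmf p κ μy x
  have hfint : Integrable f (sphereMeasure p) := by
    refine (Continuous.integrable_of_hasCompactSupport ?_ (HasCompactSupport.of_compactSpace _))
    simp only [f, vmf]
    fun_prop
  have hf1 : ∫ x, f x ∂(sphereMeasure p) = 1 := by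
    simp only [f, vmf, integral_div]
    rw [aux_partition p hp μy hμy κ hκ0]
    exact div_self hCy0.ne'
  have hpt : ∀ x : Metric.sphere (0 : EuclideanSpace ℝ (Fin p)) 1,
      ‖Real.log (vmf p κ μy x / vmf p κz μz x) * vmf p κ μy x‖ ≤ (L + D) * f x + 2 / c := by
    intro x
    have hfx : f x = vmf p κ μy x := rfl
    rw [← hfx]
    have hfe : f x = Real.exp (κ * ⟪μy, (x : EuclideanSpace ℝ (Fin p))⟫) / Cy := rfl
    have hze : vmf p κz μz x = Real.exp (κz * ⟪μz, (x : EuclideanSpace ℝ (Fin p))⟫) / Cz := rfl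
    have hy := abs_le.1 (aux_inner_le hμy x)
    have hz := abs_le.1 (aux_inner_le hμz x)
    set t := ⟪μy, (x : EuclideanSpace ℝ (Fin p))⟫
    set tz := ⟪μz, (x : EuclideanSpace ℝ (Fin p))⟫
    have hfpos : 0 < f x := by rw [hfe]; positivity
    have hlogr : Real.log (f x / vmf p κz μz x) =
        κ * t - Real.log Cy - (κz * tz - Real.log Cz) := by
      rw [Real.log_div hfpos.ne' (by rw [hze]; positivity), hfe, hze,
        Real.log_div (Real.exp_pos _).ne' hCy0.ne', Real.log_div (Real.exp_pos _).ne' hCz0.ne',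
        Real.log_exp, Real.log_exp]
    have hplog : 0 ≤ (p:ℝ) * Real.log κ := by positivity
    have habs : |Real.log (f x / vmf p κz μz x)| ≤ κ * (1 - t) + D := by
      rw [hlogr, hD, hD0, abs_le]
      have a1 := abs_le.1 (le_refl |Real.log Cz|)
      have a2 := abs_le.1 (le_refl |Real.log S|)
      have a3 := abs_le.1 (le_refl |Real.log c|)
      have b1 : κz * tz ≤ κz := by nlinarith
      have b2 : -κz ≤ κz * tz := by nlinarith
      have b3 : 0 ≤ κ * (1 - t) := mul_nonneg hκ0.le (by linarith)
      have b4 : κ * (1 - t) = κ - κ * t := by ring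
      constructor <;> linarith [abs_nonneg (Real.log Cz), abs_nonneg (Real.log S), abs_nonneg (Real.log c)]
    have hh : κ * (1 - t) * f x ≤ L * f x + 2 / c := by
      rcases le_total (κ * (1 - t)) L with h | h
      · have : κ * (1 - t) * f x ≤ L * f x := by gcongr
        have : 0 < 2 / c := by positivity
        linarith
      · have e1 : f x ≤ Real.exp (-L) * (Real.exp κ / Cy) := by
          rw [hfe, ← mul_div_assoc, ← Real.exp_add]
          gcongr
          linarith
        have e2 : f x ≤ 1 / (κ * c) := by
          calc f x ≤ Real.exp (-L) * (Real.exp κ / Cy) := e1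
            _ ≤ 1 / κ ^ (p + 1) * (κ ^ p / c) := by rw [hexpL]; gcongr
            _ = _ := by rw [pow_succ]; field_simp
        have e3 : κ * (1 - t) * f x ≤ (κ * 2) * (1 / (κ * c)) := by
          gcongr
          linarith
        have e4 : (κ * 2) * (1 / (κ * c)) = 2 / c := by field_simp
        have : 0 ≤ L * f x := by positivity
        linarith
    rw [norm_mul, Real.norm_eq_abs, Real.norm_eq_abs, abs_of_pos hfpos]
    calc |Real.log (f x / vmf p κz μz x)| * f x ≤ (κ * (1 - t) + D) * f x := by gcongr
      _ = κ * (1 - t) * f x + D * f x := by ring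
      _ ≤ _ := by linarith
  have hmain := norm_integral_le_of_norm_le (μ := sphereMeasure p)
    ((hfint.const_mul (L + D)).add (integrable_const (2 / c))) (Filter.Eventually.of_forall hpt)
  have hval : ∫ x, ((L + D) * f x + 2 / c) ∂(sphereMeasure p) = L + D + S * (2 / c) := by
    rw [integral_add (hfint.const_mul (L + D)) (integrable_const (2 / c)), integral_const_mul, hf1,
      integral_const, smul_eq_mul, mul_one]
  have hfin : |klDiv p κ κz μy μz| ≤ L + D + S * (2 / c) := by
    rw [← hval]; exact hmain
  refine hfin.trans ?_
  have h1 : D0 ≤ D0 * Real.log κ := le_mul_of_one_le_right hD0nn hlog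
  have h2 : S * (2 / c) ≤ S * (2 / c) * Real.log κ := le_mul_of_one_le_right (by positivity) hlog
  have h3 : 2 * S / c = S * (2 / c) := by ring
  rw [h3, hL, hD]
  linarith
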